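/- Let A ∈ ℝ^{n×d} with rank(A) ≥ k, and let R ∈ ℝ^{d×k} have orthonormal columns with d₂(R, V_{A,k}) ≤ ν(1+ν²)^{−1/2} < 1. Then d₂(U_{AR}, U_{A,k}) ≤ (σ_{k+1}(A)/σ_k(A))·ν, where U_{AR} is the matrix of left singular vectors in a thin SVD of AR. -/

import Mathlib

open Matrix MeasureTheory

noncomputable section

/-- Euclidean norm of a vector in `ℝ^n`. -/
def vnorm {n : ℕ} (v : Fin n → ℝ) : ℝ := Real.sqrt (∑ i, v i ^ 2)

/-- Spectral norm of a matrix (operator norm as a map between Euclidean spaces). -/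
def spec {m n : ℕ} (M : Matrix (Fin m) (Fin n) ℝ) : ℝ :=
  ‖LinearMap.toContinuousLinearMap (Matrix.toEuclideanLin M)‖

/-- The four Moore-Penrose conditions. -/
def IsMP {m n : ℕ} (X : Matrix (Fin m) (Fin n) ℝ) (Y : Matrix (Fin n) (Fin m) ℝ) : Prop :=
  X * Y * X = X ∧ Y * X * Y = Y ∧ (X * Y)ᵀ = X * Y ∧ (Y * X)ᵀ = Y * X

/-- The Moore-Penrose pseudoinverse (it always exists and is unique, so this choice-based
definition picks out exactly the Moore-Penrose pseudoinverse). -/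
def pinv {m n : ℕ} (X : Matrix (Fin m) (Fin n) ℝ) : Matrix (Fin n) (Fin m) ℝ := by
  classical exact if h : ∃ Y, IsMP X Y then h.choose else 0

/-- Orthogonal projection onto the column space of a matrix: `P_X = X X⁺`. -/
def projCol {m n : ℕ} (X : Matrix (Fin m) (Fin n) ℝ) : Matrix (Fin m) (Fin m) ℝ := X * pinv X

/-- Distance between column spaces: `d₂(U, W) = ‖P_U - P_W‖₂`. -/
def d2 {m p q : ℕ} (U : Matrix (Fin m) (Fin p) ℝ) (W : Matrix (Fin m) (Fin q) ℝ) : ℝ :=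
  spec (projCol U - projCol W)

/-- `(U, s, V)` is a thin SVD of `X`: orthonormal columns, nonincreasing nonnegative
singular values, and `X = U (diag s) Vᵀ`. -/
def IsThinSVD {m n p : ℕ} (X : Matrix (Fin m) (Fin n) ℝ) (U : Matrix (Fin m) (Fin p) ℝ)
    (s : Fin p → ℝ) (V : Matrix (Fin n) (Fin p) ℝ) : Prop :=
  Uᵀ * U = 1 ∧ Vᵀ * V = 1 ∧ Antitone s ∧ (∀ i, 0 ≤ s i) ∧ X = U * Matrix.diagonal s * Vᵀ

/-- The matrix of the first `k` columns. -/
def firstCols {m p : ℕ} (U : Matrix (Fin m) (Fin p) ℝ) (k : ℕ) (h : k ≤ p) :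
    Matrix (Fin m) (Fin k) ℝ := U.submatrix id (Fin.castLE h)

/-- The matrix of the remaining columns (columns `k+1, …, p` in 1-based indexing). -/
def tailCols {m p : ℕ} (U : Matrix (Fin m) (Fin p) ℝ) (k : ℕ) (h : k ≤ p) :
    Matrix (Fin m) (Fin (p - k)) ℝ :=
  U.submatrix id (fun j => ⟨k + j.1, by have := j.2; omega⟩)

/-- `sv s i` is the `i`-th singular value (1-indexed), `0` past the end. -/
def sv {p : ℕ} (s : Fin p → ℝ) (i : ℕ) : ℝ := by
  classical exact if h : i - 1 < p then s ⟨i - 1, h⟩ else 0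

end

theorem aux_spec_le {m n : ℕ} (M : Matrix (Fin m) (Fin n) ℝ) (c : ℝ) (hc : 0 ≤ c)
    (h : ∀ v, (M *ᵥ v) ⬝ᵥ (M *ᵥ v) ≤ c ^ 2 * (v ⬝ᵥ v)) : spec M ≤ c := by
  unfold spec
  refine ContinuousLinearMap.opNorm_le_bound _ hc fun v => ?_
  have h1 := h v.ofLp
  refine le_of_sq_le_sq ?_ (by positivity)
  rw [mul_pow, EuclideanSpace.real_norm_sq_eq, EuclideanSpace.real_norm_sq_eq]
  simp only [dotProduct, ← pow_two] at h1
  simpa using h1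

theorem aux_le_spec {m n : ℕ} (M : Matrix (Fin m) (Fin n) ℝ) (v : Fin n → ℝ) :
    (M *ᵥ v) ⬝ᵥ (M *ᵥ v) ≤ spec M ^ 2 * (v ⬝ᵥ v) := by
  have h := ContinuousLinearMap.le_opNorm
    (LinearMap.toContinuousLinearMap (Matrix.toEuclideanLin M)) (WithLp.toLp 2 v)
  have h2 := pow_le_pow_left₀ (norm_nonneg _) h 2
  rw [mul_pow, EuclideanSpace.real_norm_sq_eq, EuclideanSpace.real_norm_sq_eq] at h2
  simp only [dotProduct, ← pow_two]
  simpa [spec] using h2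

theorem aux_spec_nonneg {m n : ℕ} (M : Matrix (Fin m) (Fin n) ℝ) : 0 ≤ spec M := norm_nonneg _

theorem aux_projCol {m n : ℕ} (U : Matrix (Fin m) (Fin n) ℝ) (hU : Uᵀ * U = 1) :
    projCol U = U * Uᵀ := by
  have hex : ∃ Y, IsMP U Y := ⟨Uᵀ, by
    refine ⟨?_, ?_, ?_, ?_⟩
    · rw [Matrix.mul_assoc, hU, Matrix.mul_one]
    · rw [hU, Matrix.one_mul]
    · simp
    · simp⟩
  have hp : IsMP U (pinv U) := by
    unfold pinv
    rw [dif_pos hex]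
    exact hex.choose_spec
  obtain ⟨h1, -, h3, -⟩ := hp
  unfold projCol
  have e1 : U * pinv U * (U * Uᵀ) = U * Uᵀ := by rw [← Matrix.mul_assoc, h1]
  have e2 : U * Uᵀ * (U * pinv U) = U * pinv U := by
    rw [Matrix.mul_assoc, ← Matrix.mul_assoc Uᵀ, hU, Matrix.one_mul]
  have e3 := congrArg Matrix.transpose e2
  rw [Matrix.transpose_mul, h3, Matrix.transpose_mul, Matrix.transpose_transpose] at e3
  rw [← e3, e1]

theorem aux_sq {m : ℕ} (v : Fin m → ℝ) : 0 ≤ v ⬝ᵥ v := by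
  simpa [dotProduct] using Finset.sum_nonneg fun i _ => mul_self_nonneg (v i)

theorem aux_firstCols {m p : ℕ} (U : Matrix (Fin m) (Fin p) ℝ) (k : ℕ) (h : k ≤ p)
    (hU : Uᵀ * U = 1) : (firstCols U k h)ᵀ * firstCols U k h = 1 := by
  ext i j
  have := congrFun (congrFun hU (Fin.castLE h i)) (Fin.castLE h j)
  simp only [Matrix.mul_apply, Matrix.transpose_apply, Matrix.one_apply] at this
  simp only [Matrix.mul_apply, Matrix.transpose_apply, Matrix.one_apply, firstCols,
    Matrix.submatrix_apply, id]
  rw [this]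
  simp [Fin.ext_iff]

/-- adjoint -/
theorem aux_adj {m n : ℕ} (U : Matrix (Fin m) (Fin n) ℝ) (x : Fin n → ℝ) (y : Fin m → ℝ) :
    (U *ᵥ x) ⬝ᵥ y = x ⬝ᵥ (Uᵀ *ᵥ y) := by
  rw [Matrix.mulVec_transpose, dotProduct_comm, Matrix.dotProduct_mulVec, dotProduct_comm]

theorem aux_iso {m n : ℕ} (U : Matrix (Fin m) (Fin n) ℝ) (hU : Uᵀ * U = 1) (x : Fin n → ℝ) :
    (U *ᵥ x) ⬝ᵥ (U *ᵥ x) = x ⬝ᵥ x := by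
  rw [aux_adj, Matrix.mulVec_mulVec, hU, Matrix.one_mulVec]

/-- Pythagoras -/
theorem aux_pyth {m n : ℕ} (U : Matrix (Fin m) (Fin n) ℝ) (hU : Uᵀ * U = 1) (w : Fin m → ℝ) :
    (w - U *ᵥ (Uᵀ *ᵥ w)) ⬝ᵥ (w - U *ᵥ (Uᵀ *ᵥ w)) = w ⬝ᵥ w - (Uᵀ *ᵥ w) ⬝ᵥ (Uᵀ *ᵥ w) := by
  rw [sub_dotProduct, dotProduct_sub, dotProduct_sub, aux_iso U hU,
    dotProduct_comm w (U *ᵥ _), aux_adj]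
  ring

theorem aux_bessel {m n : ℕ} (U : Matrix (Fin m) (Fin n) ℝ) (hU : Uᵀ * U = 1) (w : Fin m → ℝ) :
    (Uᵀ *ᵥ w) ⬝ᵥ (Uᵀ *ᵥ w) ≤ w ⬝ᵥ w := by
  have := aux_sq (w - U *ᵥ (Uᵀ *ᵥ w))
  rw [aux_pyth U hU] at this
  linarith

/-- The two-projection lemma. -/
theorem aux_two_proj {m p q : ℕ} (U : Matrix (Fin m) (Fin p) ℝ) (W : Matrix (Fin m) (Fin q) ℝ)
    (hU : Uᵀ * U = 1) (hW : Wᵀ * W = 1) (τ : ℝ) (hτ : 0 ≤ τ)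
    (H1 : ∀ z, (U *ᵥ z - W *ᵥ (Wᵀ *ᵥ (U *ᵥ z))) ⬝ᵥ (U *ᵥ z - W *ᵥ (Wᵀ *ᵥ (U *ᵥ z)))
      ≤ τ ^ 2 * ((Wᵀ *ᵥ (U *ᵥ z)) ⬝ᵥ (Wᵀ *ᵥ (U *ᵥ z))))
    (H2 : ∀ u, ∃ z, Wᵀ *ᵥ (U *ᵥ z) = u) : spec (U * Uᵀ - W * Wᵀ) ≤ τ := by
  refine aux_spec_le _ _ hτ fun v => ?_
  -- first part
  set z := Uᵀ *ᵥ v with hz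
  set w := v - U *ᵥ z with hw
  have hUw : Uᵀ *ᵥ w = 0 := by
    rw [hw, Matrix.mulVec_sub, Matrix.mulVec_mulVec, hU, Matrix.one_mulVec, hz, sub_self]
  set y := Wᵀ *ᵥ w with hy
  -- claim
  have hB : ∀ t, (W *ᵥ t - U *ᵥ (Uᵀ *ᵥ (W *ᵥ t))) ⬝ᵥ (W *ᵥ t - U *ᵥ (Uᵀ *ᵥ (W *ᵥ t)))
      ≤ τ ^ 2 * (t ⬝ᵥ t) := by
    intro t
    obtain ⟨x, hx⟩ := H2 t
    have h1 := H1 x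
    rw [hx] at h1
    set g := W *ᵥ t - U *ᵥ x with hg
    have e : W *ᵥ t - U *ᵥ (Uᵀ *ᵥ (W *ᵥ t)) = g - U *ᵥ (Uᵀ *ᵥ g) := by
      rw [hg, Matrix.mulVec_sub Uᵀ, Matrix.mulVec_mulVec _ Uᵀ U, hU, Matrix.one_mulVec, Matrix.mulVec_sub]
      abel
    rw [e, aux_pyth U hU]
    have h2 := aux_sq (Uᵀ *ᵥ g)
    have h3 : g ⬝ᵥ g ≤ τ ^ 2 * (t ⬝ᵥ t) := by
      refine le_trans (le_of_eq ?_) h1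
      rw [hg, ← neg_sub (W *ᵥ t) (U *ᵥ x), neg_dotProduct_neg]
    linarith
  have hyy : y ⬝ᵥ y ≤ τ ^ 2 * (w ⬝ᵥ w) := by
    set g := W *ᵥ y - U *ᵥ (Uᵀ *ᵥ (W *ᵥ y)) with hg
    have e1 : y ⬝ᵥ y = g ⬝ᵥ w := by
      rw [hg, sub_dotProduct, aux_adj W, aux_adj U, hUw, dotProduct_zero, sub_zero]
    have h1 := hB y
    rw [← hg] at h1
    have cs : (g ⬝ᵥ w) ^ 2 ≤ (g ⬝ᵥ g) * (w ⬝ᵥ w) := by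
      simpa [dotProduct, ← pow_two] using Finset.sum_mul_sq_le_sq_mul_sq Finset.univ g w
    rw [← e1] at cs
    have hw0 := aux_sq w
    have hy0 := aux_sq y
    rcases hy0.eq_or_lt with h0 | h0
    · rw [← h0]; positivity
    · have : (y ⬝ᵥ y) * (y ⬝ᵥ y) ≤ (y ⬝ᵥ y) * (τ ^ 2 * (w ⬝ᵥ w)) := by nlinarith
      exact le_of_mul_le_mul_left this h0
  set a := U *ᵥ z - W *ᵥ (Wᵀ *ᵥ (U *ᵥ z)) with ha
  have hWa : Wᵀ *ᵥ a = 0 := by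
    rw [ha, Matrix.mulVec_sub, Matrix.mulVec_mulVec _ Wᵀ W, hW, Matrix.one_mulVec, sub_self]
  have hd : (U * Uᵀ - W * Wᵀ) *ᵥ v = a - W *ᵥ y := by
    rw [Matrix.sub_mulVec, ← Matrix.mulVec_mulVec, ← Matrix.mulVec_mulVec, ha, hy, hw, hz,
      Matrix.mulVec_sub Wᵀ, Matrix.mulVec_sub W]
    abel
  have hn : (a - W *ᵥ y) ⬝ᵥ (a - W *ᵥ y) = a ⬝ᵥ a + y ⬝ᵥ y := by
    clear_value a
    rw [sub_dotProduct, dotProduct_sub, dotProduct_sub, aux_iso W hW,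
      dotProduct_comm a (W *ᵥ _), aux_adj, hWa, dotProduct_zero]
    ring
  have ha1 := H1 z
  rw [← ha] at ha1
  have hb := aux_bessel W hW (U *ᵥ z)
  rw [aux_iso U hU] at hb
  have hww := aux_pyth U hU v
  rw [← hz, ← hw] at hww
  rw [hd, hn]
  nlinarith [sq_nonneg τ, mul_le_mul_of_nonneg_left hb (sq_nonneg τ)]

theorem aux_sum {p k : ℕ} (h : k ≤ p) (f : Fin p → ℝ) :
    ∑ i : Fin p, f i = ∑ i : Fin k, f (Fin.castLE h i)
      + ∑ i : Fin p, if i.1 < k then 0 else f i := by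
  have : ∑ i : Fin k, f (Fin.castLE h i) = ∑ i : Fin p, if i.1 < k then f i else 0 := by
    rw [← Finset.sum_filter]
    refine Finset.sum_bij (fun i _ => Fin.castLE h i) ?_ ?_ ?_ ?_
    · intro i _; simp
    · intro i _ j _ hij; simpa [Fin.ext_iff] using hij
    · intro b hb
      exact ⟨⟨b.1, by simpa using hb⟩, Finset.mem_univ _, by simp [Fin.ext_iff]⟩
    · intro i _; rfl
  rw [this, ← Finset.sum_add_distrib]
  refine Finset.sum_congr rfl fun i _ => ?_
  split_ifs <;> simp

theorem aux_pos {n d p k : ℕ} (hk0 : 0 < k) (A : Matrix (Fin n) (Fin d) ℝ)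
    (U : Matrix (Fin n) (Fin p) ℝ) (s : Fin p → ℝ) (V : Matrix (Fin d) (Fin p) ℝ)
    (h : IsThinSVD A U s V) (hr : k ≤ A.rank) (hkp : k ≤ p) : 0 < s ⟨k - 1, by omega⟩ := by
  obtain ⟨-, -, hs, h0, hA⟩ := h
  by_contra hneg
  have hz : s ⟨k - 1, by omega⟩ = 0 := le_antisymm (not_lt.mp hneg) (h0 _)
  have h1 : A.rank ≤ (Matrix.diagonal s).rank := by
    rw [hA]
    exact (Matrix.rank_mul_le_left _ _).trans (Matrix.rank_mul_le_right _ _)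
  rw [Matrix.rank_diagonal] at h1
  have h2 : Fintype.card {i // s i ≠ 0} ≤ Fintype.card (Fin (k - 1)) := by
    refine Fintype.card_le_of_injective
      (fun i => (⟨i.1.1, ?_⟩ : Fin (k - 1))) ?_
    · by_contra hc
      have : s i.1 ≤ s ⟨k - 1, by omega⟩ := hs (by rw [Fin.le_def]; simp; omega)
      exact i.2 (le_antisymm (this.trans hz.le) (h0 _))
    · intro i j hij
      simpa [Fin.ext_iff, Subtype.ext_iff] using hij
  rw [Fintype.card_fin] at h2
  omega

theorem aux_main {n d p k q : ℕ} (hk0 : 0 < k) (hq : q = k) (A : Matrix (Fin n) (Fin d) ℝ)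
    (UA : Matrix (Fin n) (Fin p) ℝ) (sA : Fin p → ℝ) (VA : Matrix (Fin d) (Fin p) ℝ)
    (hSVD : IsThinSVD A UA sA VA)
    (hkrank : k ≤ A.rank) (hkp : k ≤ p)
    (R : Matrix (Fin d) (Fin k) ℝ) (hR : Rᵀ * R = 1)
    (ν : ℝ)
    (hdist : d2 R (firstCols VA k hkp) ≤ ν / Real.sqrt (1 + ν ^ 2))
    (UR : Matrix (Fin n) (Fin q) ℝ) (sR : Fin q → ℝ)
    (VR : Matrix (Fin k) (Fin q) ℝ)
    (hSVDR : IsThinSVD (A * R) UR sR VR) :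
    d2 UR (firstCols UA k hkp) ≤ sv sA (k + 1) / sv sA k * ν := by
  subst hq
  have hpos := aux_pos hk0 A UA sA VA hSVD hkrank hkp
  obtain ⟨hU, hV, hs, hs0, hA⟩ := hSVD
  obtain ⟨hUR, -, -, -, hAR⟩ := hSVDR
  have hUk := aux_firstCols UA q hkp hU
  have hVk := aux_firstCols VA q hkp hV
  have hsvk : sv sA q = sA ⟨q - 1, by omega⟩ := by
    unfold sv; rw [dif_pos (by omega)]
  rw [← hsvk] at hpos
  have hsv1 : 0 ≤ sv sA (q + 1) := by
    unfold sv; split_ifs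
    · exact hs0 _
    · exact le_rfl
  have hlo : ∀ i : Fin q, sv sA q ≤ sA (Fin.castLE hkp i) := by
    intro i; rw [hsvk]; apply hs; rw [Fin.le_def]; simp; omega
  have hhi : ∀ i : Fin p, ¬ i.1 < q → sA i ≤ sv sA (q + 1) := by
    intro i hi
    unfold sv; rw [dif_pos (by omega)]; apply hs; rw [Fin.le_def]; simp; omega
  set σ := sv sA q
  set σ' := sv sA (q + 1)
  have hν : 0 ≤ ν := by
    have h0 : 0 ≤ ν / Real.sqrt (1 + ν ^ 2) := (aux_spec_nonneg _).trans hdist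
    have h1 : 0 < Real.sqrt (1 + ν ^ 2) := Real.sqrt_pos.mpr (by positivity)
    by_contra hc
    exact absurd h0 (not_le.mpr (div_neg_of_neg_of_pos (not_le.mp hc) h1))
  unfold d2 at hdist ⊢
  rw [aux_projCol _ hR, aux_projCol _ hVk] at hdist
  rw [aux_projCol _ hUR, aux_projCol _ hUk]
  -- coordinates
  have hVc : ∀ w i, ((firstCols VA q hkp)ᵀ *ᵥ w) i = (VAᵀ *ᵥ w) (Fin.castLE hkp i) := by
    intro w i; rfl
  have hUc : ∀ w i, ((firstCols UA q hkp)ᵀ *ᵥ w) i = (UAᵀ *ᵥ w) (Fin.castLE hkp i) := by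
    intro w i; rfl
  have hAw : ∀ w, A *ᵥ w = UA *ᵥ (fun i => sA i * (VAᵀ *ᵥ w) i) := by
    intro w
    rw [hA, ← Matrix.mulVec_mulVec, ← Matrix.mulVec_mulVec]
    congr 1
    ext i
    rw [Matrix.mulVec_diagonal]
  have hUA : ∀ w, UAᵀ *ᵥ (A *ᵥ w) = fun i => sA i * (VAᵀ *ᵥ w) i := by
    intro w
    rw [hAw, Matrix.mulVec_mulVec, hU, Matrix.one_mulVec]
  -- V side
  have hVside : ∀ x, (R *ᵥ x) ⬝ᵥ (R *ᵥ x) - ((firstCols VA q hkp)ᵀ *ᵥ (R *ᵥ x)) ⬝ᵥ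
      ((firstCols VA q hkp)ᵀ *ᵥ (R *ᵥ x)) ≤ ν ^ 2 * (((firstCols VA q hkp)ᵀ *ᵥ (R *ᵥ x)) ⬝ᵥ
      ((firstCols VA q hkp)ᵀ *ᵥ (R *ᵥ x))) := by
    intro x
    have h1 := aux_le_spec (R * Rᵀ - firstCols VA q hkp * (firstCols VA q hkp)ᵀ) (R *ᵥ x)
    rw [Matrix.sub_mulVec, Matrix.mulVec_mulVec _ _ R, Matrix.mul_assoc, hR, Matrix.mul_one,
      ← Matrix.mulVec_mulVec, aux_pyth _ hVk] at h1
    have h2 : spec (R * Rᵀ - firstCols VA q hkp * (firstCols VA q hkp)ᵀ) ^ 2 ≤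
        ν ^ 2 / (1 + ν ^ 2) := by
      refine (pow_le_pow_left₀ (aux_spec_nonneg _) hdist 2).trans (le_of_eq ?_)
      rw [div_pow, Real.sq_sqrt (by positivity)]
    have h3 := h1.trans (mul_le_mul_of_nonneg_right h2 (aux_sq _))
    rw [div_mul_eq_mul_div, le_div_iff₀ (by positivity)] at h3
    nlinarith
  -- key inequality
  have hhead : ∀ w, σ ^ 2 * (((firstCols VA q hkp)ᵀ *ᵥ w) ⬝ᵥ ((firstCols VA q hkp)ᵀ *ᵥ w)) ≤
      ((firstCols UA q hkp)ᵀ *ᵥ (A *ᵥ w)) ⬝ᵥ ((firstCols UA q hkp)ᵀ *ᵥ (A *ᵥ w)) := by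
    intro w
    simp only [dotProduct, Finset.mul_sum, hVc, hUc, hUA]
    refine Finset.sum_le_sum fun i _ => ?_
    have h1 : σ ^ 2 ≤ sA (Fin.castLE hkp i) ^ 2 := pow_le_pow_left₀ hpos.le (hlo i) 2
    nlinarith [mul_le_mul_of_nonneg_right h1 (sq_nonneg ((VAᵀ *ᵥ w) (Fin.castLE hkp i)))]
  have htail : ∀ w, (A *ᵥ w) ⬝ᵥ (A *ᵥ w) -
      ((firstCols UA q hkp)ᵀ *ᵥ (A *ᵥ w)) ⬝ᵥ ((firstCols UA q hkp)ᵀ *ᵥ (A *ᵥ w)) ≤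
      σ' ^ 2 * (w ⬝ᵥ w - ((firstCols VA q hkp)ᵀ *ᵥ w) ⬝ᵥ ((firstCols VA q hkp)ᵀ *ᵥ w)) := by
    intro w
    have hb := aux_bessel VA hV w
    have e1 : (VAᵀ *ᵥ w) ⬝ᵥ (VAᵀ *ᵥ w) = ((firstCols VA q hkp)ᵀ *ᵥ w) ⬝ᵥ
        ((firstCols VA q hkp)ᵀ *ᵥ w) + ∑ i : Fin p, if i.1 < q then 0 else
          (VAᵀ *ᵥ w) i * (VAᵀ *ᵥ w) i :=
      aux_sum hkp (fun i => (VAᵀ *ᵥ w) i * (VAᵀ *ᵥ w) i)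
    have e2 : (UAᵀ *ᵥ (A *ᵥ w)) ⬝ᵥ (UAᵀ *ᵥ (A *ᵥ w)) = ((firstCols UA q hkp)ᵀ *ᵥ (A *ᵥ w)) ⬝ᵥ
        ((firstCols UA q hkp)ᵀ *ᵥ (A *ᵥ w)) + ∑ i : Fin p, if i.1 < q then 0 else
          (UAᵀ *ᵥ (A *ᵥ w)) i * (UAᵀ *ᵥ (A *ᵥ w)) i :=
      aux_sum hkp (fun i => (UAᵀ *ᵥ (A *ᵥ w)) i * (UAᵀ *ᵥ (A *ᵥ w)) i)
    have e3 : (A *ᵥ w) ⬝ᵥ (A *ᵥ w) = (UAᵀ *ᵥ (A *ᵥ w)) ⬝ᵥ (UAᵀ *ᵥ (A *ᵥ w)) := by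
      rw [hUA, hAw, aux_iso UA hU]
    have e4 : (∑ i : Fin p, if i.1 < q then 0 else
          (UAᵀ *ᵥ (A *ᵥ w)) i * (UAᵀ *ᵥ (A *ᵥ w)) i) ≤ σ' ^ 2 * ∑ i : Fin p,
          if i.1 < q then 0 else (VAᵀ *ᵥ w) i * (VAᵀ *ᵥ w) i := by
      rw [Finset.mul_sum]
      refine Finset.sum_le_sum fun i _ => ?_
      split_ifs with hi
      · simp
      · rw [hUA]
        have h1 : sA i ^ 2 ≤ σ' ^ 2 := pow_le_pow_left₀ (hs0 i) (hhi i hi) 2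
        nlinarith [mul_le_mul_of_nonneg_right h1 (sq_nonneg ((VAᵀ *ᵥ w) i))]
    have e5 : (∑ i : Fin p, if i.1 < q then 0 else (VAᵀ *ᵥ w) i * (VAᵀ *ᵥ w) i) ≤
        w ⬝ᵥ w - ((firstCols VA q hkp)ᵀ *ᵥ w) ⬝ᵥ ((firstCols VA q hkp)ᵀ *ᵥ w) := by linarith
    have e6 := mul_le_mul_of_nonneg_left e5 (sq_nonneg σ')
    linarith
  -- injectivity
  have hinj : ∀ x, (firstCols UA q hkp)ᵀ *ᵥ (A *ᵥ (R *ᵥ x)) = 0 → x = 0 := by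
    intro x hx
    have h1 := hhead (R *ᵥ x)
    rw [hx, dotProduct_zero] at h1
    have h2 := hVside x
    have h3 := aux_sq ((firstCols VA q hkp)ᵀ *ᵥ (R *ᵥ x))
    have h4 : ((firstCols VA q hkp)ᵀ *ᵥ (R *ᵥ x)) ⬝ᵥ ((firstCols VA q hkp)ᵀ *ᵥ (R *ᵥ x)) = 0 := by
      have : 0 < σ ^ 2 := by positivity
      nlinarith
    rw [h4, aux_iso R hR] at h2
    have h5 := aux_sq x
    exact dotProduct_self_eq_zero.mp (by linarith)
  have hS : ∀ x, A *ᵥ (R *ᵥ x) = UR *ᵥ ((Matrix.diagonal sR * VRᵀ) *ᵥ x) := by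
    intro x
    rw [Matrix.mulVec_mulVec, hAR, Matrix.mulVec_mulVec, Matrix.mul_assoc]
  have surj : ∀ N : Matrix (Fin q) (Fin q) ℝ, (∀ x, N *ᵥ x = 0 → x = 0) →
      ∀ y, ∃ x, N *ᵥ x = y := by
    intro N hN
    have hi : Function.Injective N.mulVecLin := by
      rw [← LinearMap.ker_eq_bot, LinearMap.ker_eq_bot']
      intro x hx; exact hN x (by simpa using hx)
    have := LinearMap.injective_iff_surjective.mp hi
    intro y
    obtain ⟨x, hx⟩ := this y
    exact ⟨x, by simpa using hx⟩
  refine aux_two_proj UR (firstCols UA q hkp) hUR hUk _ (by positivity) ?_ ?_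
  · intro z
    obtain ⟨x, hx⟩ := surj (Matrix.diagonal sR * VRᵀ) (fun x hx => hinj x (by
      rw [hS, hx, Matrix.mulVec_zero, Matrix.mulVec_zero])) z
    rw [← hx, ← hS, aux_pyth _ hUk]
    have h1 := htail (R *ᵥ x)
    have h2 := hVside x
    have h3 := hhead (R *ᵥ x)
    have h4 : 0 < σ ^ 2 := by positivity
    refine h1.trans ((mul_le_mul_of_nonneg_left h2 (sq_nonneg σ')).trans ?_)
    have h5 := mul_le_mul_of_nonneg_left h3 (show 0 ≤ (σ' / σ * ν) ^ 2 / σ ^ 2 * σ ^ 2 by positivity)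
    have h6 : (σ' / σ * ν) ^ 2 * σ ^ 2 = σ' ^ 2 * ν ^ 2 := by field_simp
    rw [div_mul_cancel₀ _ h4.ne', ← mul_assoc, h6] at h5
    linarith
  · intro u
    obtain ⟨x, hx⟩ := surj ((firstCols UA q hkp)ᵀ * A * R) (fun x hx => hinj x (by
      rw [Matrix.mulVec_mulVec, Matrix.mulVec_mulVec]; exact hx)) u
    refine ⟨(Matrix.diagonal sR * VRᵀ) *ᵥ x, ?_⟩
    rw [← hS, Matrix.mulVec_mulVec, Matrix.mulVec_mulVec]
    exact hx

/-- Lemma 14. If `R` has `k` orthonormal columns and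
`d₂(R, V_{A,k}) ≤ ν(1+ν²)^{-1/2} < 1`, then
`d₂(U_{AR}, U_{A,k}) ≤ (σ_{k+1}(A)/σ_k(A)) ν`, where `U_{AR}` is the left factor
of any thin SVD of `A R`. -/
theorem statement6
    {n d k : ℕ} (hk0 : 0 < k)
    (A : Matrix (Fin n) (Fin d) ℝ)
    (UA : Matrix (Fin n) (Fin (min n d)) ℝ) (sA : Fin (min n d) → ℝ)
    (VA : Matrix (Fin d) (Fin (min n d)) ℝ)
    (hSVD : IsThinSVD A UA sA VA)
    (hkrank : k ≤ A.rank) (hkp : k ≤ min n d)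
    (R : Matrix (Fin d) (Fin k) ℝ) (hR : Rᵀ * R = 1)
    (ν : ℝ)
    (hdist : d2 R (firstCols VA k hkp) ≤ ν / Real.sqrt (1 + ν ^ 2))
    (hlt1 : ν / Real.sqrt (1 + ν ^ 2) < 1)
    (UR : Matrix (Fin n) (Fin (min n k)) ℝ) (sR : Fin (min n k) → ℝ)
    (VR : Matrix (Fin k) (Fin (min n k)) ℝ)
    (hSVDR : IsThinSVD (A * R) UR sR VR) :
    d2 UR (firstCols UA k hkp) ≤ sv sA (k + 1) / sv sA k * ν := by
  exact aux_main hk0 (by omega) A UA sA VA hSVD hkrank hkp R hR ν hdist UR sR VR hSVDR
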